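/- For every real number x ≠ 0 and every real number t, the identity |x − t| − |x| = −t·sign(x) + 2·∫₀ᵗ (1_{x ≤ s} − 1_{x ≤ 0}) ds holds, where the integral is the signed integral from 0 to t. -/

import Mathlib

open MeasureTheory

theorem monotone_ite_le (x : ℝ) : Monotone fun s : ℝ => if x ≤ s then (1 : ℝ) else 0 := by
  intro a b hab
  dsimp only
  split_ifs <;> linarith

theorem intervalIntegral_ite_le (x a b : ℝ) :
    ∫ s in a..b, (if x ≤ s then (1 : ℝ) else 0) = max (b - x) 0 - max (a - x) 0 := by
  refine integral_eq_of_hasDerivAt_off_countable (fun s => max (s - x) 0) _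
    (Set.countable_singleton x) (by fun_prop) ?_ (monotone_ite_le x).intervalIntegrable
  rintro s ⟨-, hs⟩
  rcases lt_or_gt_of_ne (show s ≠ x from hs) with h | h
  · rw [if_neg h.not_ge]
    refine (hasDerivAt_const s (0 : ℝ)).congr_of_eventuallyEq ?_
    filter_upwards [Iio_mem_nhds h] with y hy
    exact max_eq_right (sub_nonpos.2 (le_of_lt hy))
  · rw [if_pos h.le]
    refine ((hasDerivAt_id s).sub_const x).congr_of_eventuallyEq ?_
    filter_upwards [Ioi_mem_nhds h] with y hy
    exact max_eq_left (sub_nonneg.2 (le_of_lt hy))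

/-- Knight's identity: for `x ≠ 0` and all `t`,
`|x - t| - |x| = -t·sign(x) + 2∫₀ᵗ (1_{x ≤ s} - 1_{x ≤ 0}) ds`. -/
theorem knight_identity (x t : ℝ) (hx : x ≠ 0) :
    |x - t| - |x| =
      -t * Real.sign x +
        2 * ∫ s in (0:ℝ)..t,
          ((if x ≤ s then (1:ℝ) else 0) - (if x ≤ 0 then (1:ℝ) else 0)) := by
  rw [intervalIntegral.integral_sub (monotone_ite_le x).intervalIntegrable
    intervalIntegrable_const, intervalIntegral_ite_le, intervalIntegral.integral_const,
    smul_eq_mul]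
  rcases lt_or_gt_of_ne hx with h | h
  · rw [Real.sign_of_neg h, if_pos h.le]
    grind
  · rw [Real.sign_of_pos h, if_neg h.not_ge]
    grind
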